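/- arXiv:2308.09527 — 2 statements merged into one kernel-verified Lean document; each statement's English description precedes it below -/
import Mathlib

section
/- Under the pre-treatment factor model and the post-treatment surrogate factor model with Φγ = θ, the average treatment effect on the treated is identified via the surrogates: E[Y1 − Y0] = E[⟪X, γ⟫]. -/
open MeasureTheory Matrix

/-- A function with almost surely vanishing conditional expectation has zero integral. -/
theorem integral_eq_zero_of_condExp_ae_eq_zero {Ω E : Type*} {m m₀ : MeasurableSpace Ω}
    [NormedAddCommGroup E] [NormedSpace ℝ E] [CompleteSpace E]
    {μ : Measure Ω} (hm : m ≤ m₀) [SigmaFinite (μ.trim hm)] {f : Ω → E}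
    (hf : μ[f | m] =ᵐ[μ] 0) : ∫ ω, f ω ∂μ = 0 := by
  rw [← integral_condExp hm, integral_congr_ae hf]
  simp

/-- Under the pre-treatment factor model and the post-treatment surrogate factor
model with Φγ = θ, the ATT is identified via the surrogates: E[Y1 − Y0] = E[⟪X, γ⟫]. -/
theorem sc_att_identification_surrogates
    {Ω : Type*} [MeasurableSpace Ω] (P : Measure Ω) [IsProbabilityMeasure P]
    {F N K H : ℕ}
    (lam : Ω → Fin F → ℝ) (β : Fin F → ℝ) (Γ : Matrix (Fin F) (Fin N) ℝ)
    (rho : Ω → Fin K → ℝ) (θ : Fin K → ℝ) (Φ : Matrix (Fin K) (Fin H) ℝ)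
    (Y0 Y1 : Ω → ℝ) (W : Ω → Fin N → ℝ) (X : Ω → Fin H → ℝ)
    (εY : Ω → ℝ) (εW : Ω → Fin N → ℝ) (δ : Ω → ℝ) (εX : Ω → Fin H → ℝ)
    (hlam : Measurable lam) (hrho : Measurable rho)
    (hY0 : ∀ ω, Y0 ω = lam ω ⬝ᵥ β + εY ω)
    (hW : ∀ ω, W ω = Γ.transpose.mulVec (lam ω) + εW ω)
    (hY1 : ∀ ω, Y1 ω - Y0 ω = rho ω ⬝ᵥ θ + δ ω)
    (hX : ∀ ω, X ω = Φ.transpose.mulVec (rho ω) + εX ω)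
    (hεY : P[εY | MeasurableSpace.comap (fun ω => (lam ω, rho ω)) inferInstance] =ᵐ[P] 0)
    (hεW : ∀ i, P[(fun ω => εW ω i) |
      MeasurableSpace.comap (fun ω => (lam ω, rho ω)) inferInstance] =ᵐ[P] 0)
    (hδ : P[δ | MeasurableSpace.comap (fun ω => (lam ω, rho ω)) inferInstance] =ᵐ[P] 0)
    (hεX : ∀ i, P[(fun ω => εX ω i) |
      MeasurableSpace.comap (fun ω => (lam ω, rho ω)) inferInstance] =ᵐ[P] 0)
    (hY0int : Integrable Y0 P) (hY1int : Integrable Y1 P)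
    (hεYint : Integrable εY P) (hδint : Integrable δ P)
    (hlamint : ∀ i, Integrable (fun ω => lam ω i) P)
    (hrhoint : ∀ i, Integrable (fun ω => rho ω i) P)
    (hWint : ∀ i, Integrable (fun ω => W ω i) P)
    (hXint : ∀ i, Integrable (fun ω => X ω i) P)
    (hεWint : ∀ i, Integrable (fun ω => εW ω i) P)
    (hεXint : ∀ i, Integrable (fun ω => εX ω i) P)
    (γ : Fin H → ℝ) (hγ : Φ.mulVec γ = θ) :
    ∫ ω, (Y1 ω - Y0 ω) ∂P = ∫ ω, X ω ⬝ᵥ γ ∂P := by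
  have hm := (hlam.prodMk hrho).comap_le
  have hδ0 : ∫ ω, δ ω ∂P = 0 := integral_eq_zero_of_condExp_ae_eq_zero hm hδ
  have hεX0 : ∫ ω, εX ω ⬝ᵥ γ ∂P = 0 := by
    simp only [dotProduct]
    rw [integral_finsetSum _ fun i _ => (hεXint i).mul_const (γ i)]
    refine Finset.sum_eq_zero fun i _ => ?_
    rw [integral_mul_const, integral_eq_zero_of_condExp_ae_eq_zero hm (hεX i), zero_mul]
  have hεXγint : Integrable (fun ω => εX ω ⬝ᵥ γ) P :=
    integrable_finsetSum _ fun i _ => (hεXint i).mul_const (γ i)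
  have hrhoθint : Integrable (fun ω => rho ω ⬝ᵥ θ) P :=
    integrable_finsetSum _ fun i _ => (hrhoint i).mul_const (θ i)
  have hXγ : ∀ ω, X ω ⬝ᵥ γ = rho ω ⬝ᵥ θ + εX ω ⬝ᵥ γ := fun ω => by
    rw [hX, add_dotProduct, mulVec_transpose, ← dotProduct_mulVec, hγ]
  simp only [hY1, hXγ]
  rw [integral_add hrhoθint hδint, integral_add hrhoθint hεXγint, hδ0, hεX0]
end

section
/- Under the covariate-adjusted pre-treatment factor model and the covariate-adjusted post-treatment surrogate factor model with Γα = β and Φγ = θ, the mean of the treated potential outcome is identified: E[Y1] = E[⟪C_Y, ξ_Y⟫ + ⟪W̃, α⟫ + ⟪X̃, γ⟫], where W̃ = W − C_Wᵀ ξ_W and X̃ = X − C_Xᵀ ξ_X. -/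
open MeasureTheory Matrix

/-- An integrable function whose conditional expectation vanishes has zero mean. -/
theorem integral_eq_zero_of_condExp_ae_eq_zero_s12 {Ω : Type*} {m m₀ : MeasurableSpace Ω}
    {P : Measure Ω} [IsFiniteMeasure P] (hm : m ≤ m₀) {f : Ω → ℝ} (h : P[f | m] =ᵐ[P] 0) :
    ∫ ω, f ω ∂P = 0 := by
  rw [← integral_condExp hm, integral_congr_ae h]
  simp

theorem integrable_dotProduct_const {Ω ι : Type*} [MeasurableSpace Ω] [Fintype ι]
    {P : Measure Ω} {e : Ω → ι → ℝ} (he : ∀ i, Integrable (fun ω => e ω i) P) (a : ι → ℝ) :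
    Integrable (fun ω => e ω ⬝ᵥ a) P :=
  integrable_finsetSum _ fun i _ => (he i).mul_const (a i)

theorem integral_dotProduct_const_eq_zero {Ω ι : Type*} [MeasurableSpace Ω] [Fintype ι]
    {P : Measure Ω} {e : Ω → ι → ℝ} (he : ∀ i, Integrable (fun ω => e ω i) P)
    (h : ∀ i, ∫ ω, e ω i ∂P = 0) (a : ι → ℝ) :
    ∫ ω, e ω ⬝ᵥ a ∂P = 0 := by
  simp only [dotProduct]
  rw [integral_finsetSum _ fun i _ => (he i).mul_const (a i)]
  simp [integral_mul_const, h]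

/-- Under the covariate-adjusted pre-treatment factor model and the
covariate-adjusted post-treatment surrogate factor model with Γα = β and Φγ = θ, the mean of
the treated potential outcome is identified:
E[Y1] = E[⟪C_Y, ξ_Y⟫ + ⟪W̃, α⟫ + ⟪X̃, γ⟫], where W̃ = W − C_Wᵀ ξ_W and X̃ = X − C_Xᵀ ξ_X. -/
theorem sc_identification_Y1_covariates
    {Ω : Type*} [MeasurableSpace Ω] (P : Measure Ω) [IsProbabilityMeasure P]
    {F N K H pY pW pX : ℕ}
    (lam : Ω → Fin F → ℝ) (β : Fin F → ℝ) (Γ : Matrix (Fin F) (Fin N) ℝ)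
    (rho : Ω → Fin K → ℝ) (θ : Fin K → ℝ) (Φ : Matrix (Fin K) (Fin H) ℝ)
    (CY : Ω → Fin pY → ℝ) (ξY : Fin pY → ℝ)
    (CW : Ω → Fin pW → Fin N → ℝ) (ξW : Fin pW → ℝ)
    (CX : Ω → Fin pX → Fin H → ℝ) (ξX : Fin pX → ℝ)
    (Y0 Y1 : Ω → ℝ) (W : Ω → Fin N → ℝ) (X : Ω → Fin H → ℝ)
    (εY : Ω → ℝ) (εW : Ω → Fin N → ℝ) (δ : Ω → ℝ) (εX : Ω → Fin H → ℝ)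
    (hlam : Measurable lam) (hrho : Measurable rho)
    (hCY : Measurable CY) (hCW : Measurable CW) (hCX : Measurable CX)
    (hY0 : ∀ ω, Y0 ω = lam ω ⬝ᵥ β + CY ω ⬝ᵥ ξY + εY ω)
    (hW : ∀ ω, W ω = Γ.transpose.mulVec (lam ω)
      + (Matrix.of (CW ω)).transpose.mulVec ξW + εW ω)
    (hY1 : ∀ ω, Y1 ω - Y0 ω = rho ω ⬝ᵥ θ + δ ω)
    (hX : ∀ ω, X ω = Φ.transpose.mulVec (rho ω)
      + (Matrix.of (CX ω)).transpose.mulVec ξX + εX ω)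
    (hεY : P[εY |
      MeasurableSpace.comap (fun ω => (lam ω, CY ω, CW ω)) inferInstance] =ᵐ[P] 0)
    (hεW : ∀ i, P[(fun ω => εW ω i) |
      MeasurableSpace.comap (fun ω => (lam ω, CY ω, CW ω)) inferInstance] =ᵐ[P] 0)
    (hδ : P[δ | MeasurableSpace.comap (fun ω => (lam ω, rho ω)) inferInstance] =ᵐ[P] 0)
    (hεX : ∀ i, P[(fun ω => εX ω i) |
      MeasurableSpace.comap (fun ω => (lam ω, rho ω, CX ω)) inferInstance] =ᵐ[P] 0)
    (hY0int : Integrable Y0 P) (hY1int : Integrable Y1 P)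
    (hεYint : Integrable εY P) (hδint : Integrable δ P)
    (hlamint : ∀ i, Integrable (fun ω => lam ω i) P)
    (hrhoint : ∀ i, Integrable (fun ω => rho ω i) P)
    (hCYint : ∀ i, Integrable (fun ω => CY ω i) P)
    (hCWint : ∀ k i, Integrable (fun ω => CW ω k i) P)
    (hCXint : ∀ k i, Integrable (fun ω => CX ω k i) P)
    (hWint : ∀ i, Integrable (fun ω => W ω i) P)
    (hXint : ∀ i, Integrable (fun ω => X ω i) P)
    (hεWint : ∀ i, Integrable (fun ω => εW ω i) P)
    (hεXint : ∀ i, Integrable (fun ω => εX ω i) P)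
    (α : Fin N → ℝ) (hα : Γ.mulVec α = β)
    (γ : Fin H → ℝ) (hγ : Φ.mulVec γ = θ) :
    ∫ ω, Y1 ω ∂P
      = ∫ ω, (CY ω ⬝ᵥ ξY + (W ω - (Matrix.of (CW ω)).transpose.mulVec ξW) ⬝ᵥ α
        + (X ω - (Matrix.of (CX ω)).transpose.mulVec ξX) ⬝ᵥ γ) ∂P := by
  have hY : Measurable fun ω => (lam ω, CY ω, CW ω) := hlam.prodMk (hCY.prodMk hCW)
  have hS : Measurable fun ω => (lam ω, rho ω) := hlam.prodMk hrho
  have hSX : Measurable fun ω => (lam ω, rho ω, CX ω) := hlam.prodMk (hrho.prodMk hCX)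
  have eY := integral_eq_zero_of_condExp_ae_eq_zero_s12 hY.comap_le hεY
  have eδ := integral_eq_zero_of_condExp_ae_eq_zero_s12 hS.comap_le hδ
  have eW := integral_dotProduct_const_eq_zero hεWint
    (fun i => integral_eq_zero_of_condExp_ae_eq_zero_s12 hY.comap_le (hεW i)) α
  have eX := integral_dotProduct_const_eq_zero hεXint
    (fun i => integral_eq_zero_of_condExp_ae_eq_zero_s12 hSX.comap_le (hεX i)) γ
  have iW := integrable_dotProduct_const hεWint α
  have iX := integrable_dotProduct_const hεXint γ
  have key : ∀ ω, CY ω ⬝ᵥ ξY + (W ω - (Matrix.of (CW ω)).transpose.mulVec ξW) ⬝ᵥ α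
        + (X ω - (Matrix.of (CX ω)).transpose.mulVec ξX) ⬝ᵥ γ
      = Y1 ω - εY ω - δ ω + εW ω ⬝ᵥ α + εX ω ⬝ᵥ γ := fun ω => by
    have h0 := hY0 ω
    have h1 := hY1 ω
    rw [← hα, dotProduct_mulVec, ← mulVec_transpose] at h0
    rw [← hγ, dotProduct_mulVec, ← mulVec_transpose] at h1
    rw [hW, hX]
    simp only [sub_dotProduct, add_dotProduct]
    linarith
  have i₁ : Integrable (fun ω => Y1 ω - εY ω) P := hY1int.sub hεYint
  have i₂ : Integrable (fun ω => Y1 ω - εY ω - δ ω) P := i₁.sub hδint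
  have i₃ : Integrable (fun ω => Y1 ω - εY ω - δ ω + εW ω ⬝ᵥ α) P := i₂.add iW
  simp_rw [key]
  rw [integral_add i₃ iX, integral_add i₂ iW, integral_sub i₁ hδint,
    integral_sub hY1int hεYint, eY, eδ, eW, eX]
  simp
end
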